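/- arXiv:2503.12176 — 2 statements merged into one kernel-verified Lean document; each statement's English description precedes it below -/
import Mathlib

section
/- (Theorem 3.1) Let the sequences (xᵏ, yᵏ, uᵏ, θ_k) be generated by the FPSA iteration. Then for every k, φ(xᵏ⁺¹, uᵏ⁺¹) + θ_k·f(Kxᵏ) − θ_k·(⟨Kxᵏ⁺¹, yᵏ⁺¹⟩ − f*(yᵏ⁺¹)) ≤ φ(xᵏ, uᵏ) − ϱ₁‖xᵏ − xᵏ⁺¹‖² − ϱ₂‖uᵏ − uᵏ⁺¹‖². -/
open Filter Metric Set RealInnerProductSpace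
open scoped Topology Classical

noncomputable section

/-- Convexity for extended-real-valued functions. -/
def ERealConvex {α : Type*} [AddCommGroup α] [Module ℝ α] (f : α → EReal) : Prop :=
  ∀ x y : α, ∀ a b : ℝ, 0 ≤ a → 0 ≤ b → a + b = 1 →
    f (a • x + b • y) ≤ (a : EReal) * f x + (b : EReal) * f y

/-- A proper extended-real-valued function: never `⊥` and finite somewhere. -/
def ERealProper {α : Type*} (f : α → EReal) : Prop :=
  (∀ x, f x ≠ ⊥) ∧ ∃ x, f x ≠ ⊤

/-- Effective domain of an extended-real-valued function. -/
def edom {α : Type*} (f : α → EReal) : Set α := {x | f x ≠ ⊤}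

/-- Convex (Fenchel) conjugate. -/
def econj {α : Type*} [NormedAddCommGroup α] [InnerProductSpace ℝ α]
    (f : α → EReal) (y : α) : EReal :=
  ⨆ z, (((⟪z, y⟫ : ℝ) : EReal) - f z)

/-- Convex subdifferential. -/
def csubdiff {α : Type*} [NormedAddCommGroup α] [InnerProductSpace ℝ α]
    (f : α → EReal) (z : α) : Set α :=
  {v | ∀ w, f z + ((⟪v, w - z⟫ : ℝ) : EReal) ≤ f w}

/-- Normal cone of a convex set. -/
def normalCone {α : Type*} [NormedAddCommGroup α] [InnerProductSpace ℝ α]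
    (S : Set α) (x : α) : Set α :=
  {v | ∀ z ∈ S, ⟪v, z - x⟫ ≤ 0}

/-- Calmness of an extended-real-valued function at a point of its domain. -/
def ECalm {α : Type*} [NormedAddCommGroup α] (f : α → EReal) (y : α) : Prop :=
  f y ≠ ⊤ ∧ ∃ ϱ > (0:ℝ), ∃ ε > (0:ℝ), ∀ y' ∈ Metric.ball y ε,
    f y - ((ϱ * ‖y' - y‖ : ℝ) : EReal) ≤ f y' ∧ f y' ≤ f y + ((ϱ * ‖y' - y‖ : ℝ) : EReal)

/-- Fréchet subdifferential of an extended-real-valued function of one variable. -/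
def fsub {α : Type*} [NormedAddCommGroup α] [InnerProductSpace ℝ α]
    (f : α → EReal) (x : α) : Set α :=
  {v | 0 ≤ Filter.liminf
      (fun z => (f z - f x - ((⟪v, z - x⟫ : ℝ) : EReal)) * (((‖z - x‖)⁻¹ : ℝ) : EReal))
      (𝓝[≠] x)}

/-- Fréchet subdifferential of a function of two (inner-product-space) variables. -/
def fsub2 {α β : Type*} [NormedAddCommGroup α] [InnerProductSpace ℝ α]
    [NormedAddCommGroup β] [InnerProductSpace ℝ β]
    (Φ : α → β → EReal) (a : α) (b : β) : Set (α × β) :=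
  {v | 0 ≤ Filter.liminf
      (fun w : α × β =>
        (Φ w.1 w.2 - Φ a b - ((⟪v.1, w.1 - a⟫ + ⟪v.2, w.2 - b⟫ : ℝ) : EReal)) *
          (((‖w - (a, b)‖)⁻¹ : ℝ) : EReal))
      (𝓝[≠] (a, b))}

/-- Limiting (Mordukhovich) subdifferential of a function of two variables. -/
def lsub2 {α β : Type*} [NormedAddCommGroup α] [InnerProductSpace ℝ α]
    [NormedAddCommGroup β] [InnerProductSpace ℝ β]
    (Φ : α → β → EReal) (a : α) (b : β) : Set (α × β) :=
  {v | ∃ w : ℕ → α × β, ∃ vs : ℕ → α × β,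
      Tendsto w atTop (𝓝 (a, b)) ∧
      Tendsto (fun k => Φ (w k).1 (w k).2) atTop (𝓝 (Φ a b)) ∧
      (∀ k, vs k ∈ fsub2 Φ (w k).1 (w k).2) ∧
      Tendsto vs atTop (𝓝 v)}

/-- Fréchet subdifferential of a function of three variables. -/
def fsub3 {α β γ : Type*} [NormedAddCommGroup α] [InnerProductSpace ℝ α]
    [NormedAddCommGroup β] [InnerProductSpace ℝ β]
    [NormedAddCommGroup γ] [InnerProductSpace ℝ γ]
    (Φ : α → β → γ → EReal) (a : α) (b : β) (c : γ) : Set (α × β × γ) :=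
  {v | 0 ≤ Filter.liminf
      (fun w : α × β × γ =>
        (Φ w.1 w.2.1 w.2.2 - Φ a b c -
          ((⟪v.1, w.1 - a⟫ + ⟪v.2.1, w.2.1 - b⟫ + ⟪v.2.2, w.2.2 - c⟫ : ℝ) : EReal)) *
          (((‖w - (a, b, c)‖)⁻¹ : ℝ) : EReal))
      (𝓝[≠] (a, b, c))}

/-- Limiting (Mordukhovich) subdifferential of a function of three variables. -/
def lsub3 {α β γ : Type*} [NormedAddCommGroup α] [InnerProductSpace ℝ α]
    [NormedAddCommGroup β] [InnerProductSpace ℝ β]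
    [NormedAddCommGroup γ] [InnerProductSpace ℝ γ]
    (Φ : α → β → γ → EReal) (a : α) (b : β) (c : γ) : Set (α × β × γ) :=
  {v | ∃ w : ℕ → α × β × γ, ∃ vs : ℕ → α × β × γ,
      Tendsto w atTop (𝓝 (a, b, c)) ∧
      Tendsto (fun k => Φ (w k).1 (w k).2.1 (w k).2.2) atTop (𝓝 (Φ a b c)) ∧
      (∀ k, vs k ∈ fsub3 Φ (w k).1 (w k).2.1 (w k).2.2) ∧
      Tendsto vs atTop (𝓝 v)}

/-- A polyhedral set: a finite intersection of closed half-spaces. -/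
def IsPolyhedral {α : Type*} [NormedAddCommGroup α] [InnerProductSpace ℝ α]
    (S : Set α) : Prop :=
  ∃ (m : ℕ) (a : Fin m → α) (b : Fin m → ℝ), S = {z | ∀ i, ⟪a i, z⟫ ≤ b i}

/-- The merit function φ(x,u) = g(x) + h(x) + ι_S(x) + (1/(2δ))‖x-u‖². -/
def phiF {n : ℕ} (S : Set (EuclideanSpace ℝ (Fin n)))
    (g : EuclideanSpace ℝ (Fin n) → EReal) (h : EuclideanSpace ℝ (Fin n) → ℝ) (δ : ℝ)
    (x u : EuclideanSpace ℝ (Fin n)) : EReal :=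
  g x + ((h x : ℝ) : EReal) + (if x ∈ S then (0 : EReal) else ⊤)
    + (((2 * δ)⁻¹ * ‖x - u‖ ^ 2 : ℝ) : EReal)

/-- ϑ(x,u) = φ(x,u)/f(Kx). -/
def varthetaF {n p : ℕ} (S : Set (EuclideanSpace ℝ (Fin n)))
    (g : EuclideanSpace ℝ (Fin n) → EReal) (h : EuclideanSpace ℝ (Fin n) → ℝ)
    (f : EuclideanSpace ℝ (Fin p) → EReal)
    (K : EuclideanSpace ℝ (Fin n) →ₗ[ℝ] EuclideanSpace ℝ (Fin p)) (δ : ℝ)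
    (x u : EuclideanSpace ℝ (Fin n)) : EReal :=
  phiF S g h δ x u / f (K x)

/-- ϖ(x,y,u) = φ(x,u)/(⟨Kx,y⟩ - f*(y)). -/
def varpiF {n p : ℕ} (S : Set (EuclideanSpace ℝ (Fin n)))
    (g : EuclideanSpace ℝ (Fin n) → EReal) (h : EuclideanSpace ℝ (Fin n) → ℝ)
    (f : EuclideanSpace ℝ (Fin p) → EReal)
    (K : EuclideanSpace ℝ (Fin n) →ₗ[ℝ] EuclideanSpace ℝ (Fin p)) (δ : ℝ)
    (x : EuclideanSpace ℝ (Fin n)) (y : EuclideanSpace ℝ (Fin p))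
    (u : EuclideanSpace ℝ (Fin n)) : EReal :=
  phiF S g h δ x u / (((⟪K x, y⟫ : ℝ) : EReal) - econj f y)

/-- The descent lemma on a segment along which the gradient is `L`-Lipschitz from its
starting point. -/
lemma descent_of_gradient_lipschitz {E : Type*} [NormedAddCommGroup E] [InnerProductSpace ℝ E]
    [CompleteSpace E] {h : E → ℝ} {gh : E → E} {a b : E} {L : ℝ}
    (hgrad : ∀ z ∈ segment ℝ a b, HasGradientAt h (gh z) z)
    (hlip : ∀ z ∈ segment ℝ a b, ‖gh z - gh a‖ ≤ L * ‖z - a‖) :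
    h b ≤ h a + ⟪gh a, b - a⟫ + L / 2 * ‖b - a‖ ^ 2 := by
  have hmem : ∀ t ∈ Icc (0 : ℝ) 1, a + t • (b - a) ∈ segment ℝ a b := by
    intro t ht
    rw [segment_eq_image']
    exact ⟨t, ht, rfl⟩
  have hderiv : ∀ t ∈ Icc (0 : ℝ) 1, HasDerivAt
      (fun t : ℝ => h (a + t • (b - a)) - t * ⟪gh a, b - a⟫ - L / 2 * ‖b - a‖ ^ 2 * t ^ 2)
      (⟪gh (a + t • (b - a)), b - a⟫ - ⟪gh a, b - a⟫ - L * ‖b - a‖ ^ 2 * t) t := by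
    intro t ht
    have hline : HasDerivAt (fun t : ℝ => a + t • (b - a)) (b - a) t := by
      simpa using ((hasDerivAt_id t).smul_const (b - a)).const_add a
    have hcomp := (hgrad _ (hmem t ht)).hasFDerivAt.comp_hasDerivAt t hline
    have hlin := (hasDerivAt_id t).mul_const ⟪gh a, b - a⟫
    have hquad := ((hasDerivAt_id t).pow 2).const_mul (L / 2 * ‖b - a‖ ^ 2)
    refine ((hcomp.sub hlin).sub hquad).congr_deriv ?_
    simp only [InnerProductSpace.toDual_apply_apply, id, Nat.cast_ofNat]
    ring
  have hanti : AntitoneOn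
      (fun t : ℝ => h (a + t • (b - a)) - t * ⟪gh a, b - a⟫ - L / 2 * ‖b - a‖ ^ 2 * t ^ 2)
      (Icc 0 1) := by
    refine antitoneOn_of_deriv_nonpos (convex_Icc 0 1)
      (fun t ht => (hderiv t ht).continuousAt.continuousWithinAt)
      (fun t ht => (hderiv t (interior_subset ht)).differentiableAt.differentiableWithinAt) ?_
    intro t ht
    have ht' := interior_subset ht
    rw [(hderiv t ht').deriv, ← inner_sub_left]
    have hL : ‖gh (a + t • (b - a)) - gh a‖ ≤ L * (t * ‖b - a‖) := by
      simpa [norm_smul, abs_of_nonneg ht'.1] using hlip _ (hmem t ht')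
    have hcs := real_inner_le_norm (gh (a + t • (b - a)) - gh a) (b - a)
    have hmul := mul_le_mul_of_nonneg_right hL (norm_nonneg (b - a))
    linarith
  have hle := hanti (left_mem_Icc.2 zero_le_one) (right_mem_Icc.2 zero_le_one) zero_le_one
  simp only [one_smul, zero_smul, add_sub_cancel, add_zero] at hle
  linarith

/-- The quadratic growth of `g + ‖· - c‖² / (2δ)` at its minimizer `a` over a convex set. -/
lemma ERealConvex.prox_growth {E : Type*} [NormedAddCommGroup E] [InnerProductSpace ℝ E]
    {g : E → EReal} (hg : ERealConvex g) {S : Set E} (hS : Convex ℝ S) {δ : ℝ} {a b c : E}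
    (ha : a ∈ S) (hb : b ∈ S) {ga gb : ℝ} (hga : g a = ga) (hgb : g b = gb)
    (hmin : ∀ w ∈ S, g a + (((2 * δ)⁻¹ * ‖a - c‖ ^ 2 : ℝ) : EReal)
      ≤ g w + (((2 * δ)⁻¹ * ‖w - c‖ ^ 2 : ℝ) : EReal)) :
    ga + (2 * δ)⁻¹ * ‖a - c‖ ^ 2 + (2 * δ)⁻¹ * ‖b - a‖ ^ 2 ≤ gb + (2 * δ)⁻¹ * ‖b - c‖ ^ 2 := by
  have hnorm : ∀ t : ℝ, ‖(1 - t) • a + t • b - c‖ ^ 2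
      = ‖a - c‖ ^ 2 + 2 * t * ⟪a - c, b - a⟫ + t ^ 2 * ‖b - a‖ ^ 2 := by
    intro t
    rw [show (1 - t) • a + t • b - c = (a - c) + t • (b - a) by module, norm_add_sq_real,
      real_inner_smul_right, norm_smul, mul_pow, Real.norm_eq_abs, sq_abs]
    ring
  have hstep : ∀ t ∈ Ioc (0 : ℝ) 1,
      ga - gb - (2 * δ)⁻¹ * (2 * ⟪a - c, b - a⟫) ≤ t * ((2 * δ)⁻¹ * ‖b - a‖ ^ 2) := by
    intro t ht
    have hconv := hg a b (1 - t) t (by linarith [ht.2]) ht.1.le (by ring)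
    have hle := (hmin _ (hS ha hb (by linarith [ht.2]) ht.1.le (by ring))).trans
      (add_le_add_left hconv _)
    rw [hga, hgb, hnorm] at hle
    norm_cast at hle
    refine le_of_mul_le_mul_left ?_ ht.1
    linarith
  have hlim : Tendsto (fun t : ℝ => t * ((2 * δ)⁻¹ * ‖b - a‖ ^ 2)) (𝓝[>] 0) (𝓝 0) := by
    have : Continuous (fun t : ℝ => t * ((2 * δ)⁻¹ * ‖b - a‖ ^ 2)) := by fun_prop
    simpa using (this.tendsto 0).mono_left nhdsWithin_le_nhds
  have hvar := ge_of_tendsto hlim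
    (eventually_of_mem (Ioc_mem_nhdsGT zero_lt_one) hstep)
  have hone := hnorm 1
  simp only [sub_self, zero_smul, one_smul, zero_add] at hone
  rw [hone]
  linarith

/-- Equality case of the Fenchel-Young inequality. -/
lemma econj_eq_of_mem_csubdiff {E : Type*} [NormedAddCommGroup E] [InnerProductSpace ℝ E]
    {f : E → EReal} {z v : E} {r : ℝ} (hz : f z = r) (hv : v ∈ csubdiff f z) :
    econj f v = ((⟪z, v⟫ - r : ℝ) : EReal) := by
  refine le_antisymm (iSup_le fun w => ?_) ?_
  · have hw := hv w
    rw [hz, ← EReal.coe_add] at hw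
    calc ((⟪w, v⟫ : ℝ) : EReal) - f w
        ≤ ((⟪w, v⟫ : ℝ) : EReal) - ((r + ⟪v, w - z⟫ : ℝ) : EReal) := EReal.sub_le_sub le_rfl hw
      _ = ((⟪z, v⟫ - r : ℝ) : EReal) := by
        rw [← EReal.coe_sub, inner_sub_right, real_inner_comm w v, real_inner_comm z v]
        congr 1
        ring
  · refine le_iSup_of_le z ?_
    rw [hz, EReal.coe_sub]

lemma phiF_eq_coe {n : ℕ} {S : Set (EuclideanSpace ℝ (Fin n))}
    {g : EuclideanSpace ℝ (Fin n) → EReal} (h : EuclideanSpace ℝ (Fin n) → ℝ) (δ : ℝ)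
    {x : EuclideanSpace ℝ (Fin n)} (u : EuclideanSpace ℝ (Fin n)) (hx : x ∈ S) {r : ℝ}
    (hr : g x = r) :
    phiF S g h δ x u = ((r + h x + (2 * δ)⁻¹ * ‖x - u‖ ^ 2 : ℝ) : EReal) := by
  simp [phiF, hx, hr]

theorem stmt3 {n p : ℕ}
    (S : Set (EuclideanSpace ℝ (Fin n)))
    (g : EuclideanSpace ℝ (Fin n) → EReal)
    (h : EuclideanSpace ℝ (Fin n) → ℝ)
    (gh : EuclideanSpace ℝ (Fin n) → EuclideanSpace ℝ (Fin n))
    (f : EuclideanSpace ℝ (Fin p) → EReal)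
    (K : EuclideanSpace ℝ (Fin n) →ₗ[ℝ] EuclideanSpace ℝ (Fin p))
    (L δ : ℝ)
    (hS : S.Nonempty) (hSconv : Convex ℝ S) (hScomp : IsCompact S)
    (hgP : ERealProper g) (hgconv : ERealConvex g) (hglsc : LowerSemicontinuous g)
    (hfP : ERealProper f) (hfconv : ERealConvex f) (hflsc : LowerSemicontinuous f)
    (hL : 0 < L)
    (hhC1 : ∃ O : Set (EuclideanSpace ℝ (Fin n)), IsOpen O ∧ S ⊆ O ∧
      (∀ z ∈ O, HasGradientAt h (gh z) z) ∧
      (∀ z ∈ O, ∀ w ∈ O, ‖gh z - gh w‖ ≤ L * ‖z - w‖))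
    (hKS : ∀ z ∈ S, K z ∈ interior (edom f))
    (hfpos : ∀ z ∈ S, (0 : EReal) < f (K z))
    (hghnn : ∀ z ∈ S, (0 : EReal) ≤ g z + ((h z : ℝ) : EReal))
    (hSg : ∃ z ∈ S, g z ≠ ⊤)
    (hδ : 0 < δ) (hδL : δ < 1 / L)
    (σ : ℝ) (hσ : 0 < σ) (hσ2 : σ < 2)
    (x u : ℕ → EuclideanSpace ℝ (Fin n)) (y : ℕ → EuclideanSpace ℝ (Fin p)) (θ : ℕ → ℝ)
    (hxS : ∀ k, x k ∈ S ∧ g (x k) ≠ ⊤)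
    (hy : ∀ k, y (k+1) ∈ csubdiff f (K (x k)))
    (hxmin : ∀ k, ∀ w ∈ S,
      g (x (k+1)) + (((2*δ)⁻¹ * ‖x (k+1) - u k + δ • gh (x k)
          - (θ k * δ) • (LinearMap.adjoint K) (y (k+1))‖ ^ 2 : ℝ) : EReal)
        ≤ g w + (((2*δ)⁻¹ * ‖w - u k + δ • gh (x k)
          - (θ k * δ) • (LinearMap.adjoint K) (y (k+1))‖ ^ 2 : ℝ) : EReal))
    (hu : ∀ k, u (k+1) = (1 - σ) • u k + σ • x (k+1))
    (hθ : ∀ k, (θ k : EReal) = varthetaF S g h f K δ (x k) (u k))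
    (hθnn : ∀ k, 0 ≤ θ k)
    :
    ∀ k : ℕ,
      phiF S g h δ (x (k+1)) (u (k+1))
        + ((θ k : ℝ) : EReal) * f (K (x k))
        - ((θ k : ℝ) : EReal) * (((⟪K (x (k+1)), y (k+1)⟫ : ℝ) : EReal) - econj f (y (k+1)))
      ≤ phiF S g h δ (x k) (u k)
        - ((((1 - δ * L) / (2 * δ)) * ‖x k - x (k+1)‖ ^ 2 : ℝ) : EReal)
        - ((((1 - (1 - σ) ^ 2) / (2 * σ ^ 2 * δ)) * ‖u k - u (k+1)‖ ^ 2 : ℝ) : EReal) := by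
  intro k
  obtain ⟨O, -, hSO, hgrad, hlip⟩ := hhC1
  obtain ⟨hxk, hgxk⟩ := hxS k
  obtain ⟨hxk', hgxk'⟩ := hxS (k + 1)
  obtain ⟨ga, hga⟩ : ∃ r : ℝ, g (x k) = r := ⟨_, (EReal.coe_toReal hgxk (hgP.1 _)).symm⟩
  obtain ⟨gb, hgb⟩ : ∃ r : ℝ, g (x (k + 1)) = r :=
    ⟨_, (EReal.coe_toReal hgxk' (hgP.1 _)).symm⟩
  obtain ⟨r, hf⟩ : ∃ r : ℝ, f (K (x k)) = r :=
    ⟨_, (EReal.coe_toReal (interior_subset (hKS _ hxk)) (hfP.1 _)).symm⟩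
  have hseg : ∀ z ∈ segment ℝ (x k) (x (k + 1)), z ∈ O :=
    fun z hz => hSO (hSconv.segment_subset hxk hxk' hz)
  have hdesc := descent_of_gradient_lipschitz (fun z hz => hgrad z (hseg z hz))
    (fun z hz => hlip z (hseg z hz) (x k) (hSO hxk))
  set v := gh (x k) - θ k • LinearMap.adjoint K (y (k + 1)) with hv
  have hsub : ∀ w, w - u k + δ • gh (x k) - (θ k * δ) • LinearMap.adjoint K (y (k + 1))
      = w - (u k - δ • v) := by
    intro w
    rw [hv]
    module
  have hgrowth := hgconv.prox_growth hSconv (c := u k - δ • v) (δ := δ) hxk' hxk hgb hga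
    (fun w hw => by simpa only [hsub] using hxmin k w hw)
  have hexp : ∀ w, (2 * δ)⁻¹ * ‖w - (u k - δ • v)‖ ^ 2
      = (2 * δ)⁻¹ * ‖w - u k‖ ^ 2 + ⟪w - u k, v⟫ + δ / 2 * ‖v‖ ^ 2 := by
    intro w
    rw [show w - (u k - δ • v) = (w - u k) + δ • v by module, norm_add_sq_real,
      real_inner_smul_right, norm_smul, mul_pow, Real.norm_eq_abs, sq_abs]
    field_simp
  rw [hexp, hexp] at hgrowth
  have hinner : ⟪x (k + 1) - u k, v⟫ - ⟪x k - u k, v⟫ = ⟪gh (x k), x (k + 1) - x k⟫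
      - θ k * (⟪K (x (k + 1)), y (k + 1)⟫ - ⟪K (x k), y (k + 1)⟫) := by
    rw [← inner_sub_left, sub_sub_sub_cancel_right, hv, inner_sub_right, real_inner_smul_right,
      LinearMap.adjoint_inner_right, map_sub, inner_sub_left (K _), real_inner_comm]
  have hxu : ‖x (k + 1) - u (k + 1)‖ ^ 2 = (1 - σ) ^ 2 * ‖x (k + 1) - u k‖ ^ 2 := by
    rw [hu, show x (k + 1) - ((1 - σ) • u k + σ • x (k + 1)) = (1 - σ) • (x (k + 1) - u k) by
      module, norm_smul, mul_pow, Real.norm_eq_abs, sq_abs]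
  have huu : ‖u k - u (k + 1)‖ ^ 2 = σ ^ 2 * ‖x (k + 1) - u k‖ ^ 2 := by
    rw [hu, show u k - ((1 - σ) • u k + σ • x (k + 1)) = (-σ) • (x (k + 1) - u k) by
      module, norm_smul, mul_pow, Real.norm_eq_abs, sq_abs, neg_sq]
  rw [phiF_eq_coe h δ _ hxk hga, phiF_eq_coe h δ _ hxk' hgb,
    econj_eq_of_mem_csubdiff hf (hy k), hf, hxu, huu]
  norm_cast
  have hrho₁ : (1 - δ * L) / (2 * δ) * ‖x k - x (k + 1)‖ ^ 2
      = (2 * δ)⁻¹ * ‖x k - x (k + 1)‖ ^ 2 - L / 2 * ‖x k - x (k + 1)‖ ^ 2 := by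
    field_simp
  have hrho₂ : (1 - (1 - σ) ^ 2) / (2 * σ ^ 2 * δ) * (σ ^ 2 * ‖x (k + 1) - u k‖ ^ 2)
      = (2 * δ)⁻¹ * ‖x (k + 1) - u k‖ ^ 2
        - (2 * δ)⁻¹ * ((1 - σ) ^ 2 * ‖x (k + 1) - u k‖ ^ 2) := by
    field_simp
  rw [hrho₁, hrho₂]
  rw [norm_sub_rev (x (k + 1)) (x k)] at hdesc
  linarith
end
end

section
/- (Theorem 3.3(iii)) Let the sequences (xᵏ, yᵏ, uᵏ, θ_k) be generated by the FPSA iteration, assume additionally ri(S) ∩ ri(dom g) ≠ ∅ (or S polyhedral and S ∩ ri(dom g) ≠ ∅), and let θ̄ = lim_{k→∞} θ_k. Then every accumulation point x̄ of (xᵏ) is a lifted stationary point of the problem min_{x∈S}(g(x)+h(x))/f(Kx), i.e. 0 ∈ (∂g(x̄) + ∇h(x̄) + N_S(x̄))·f(Kx̄) − (g(x̄) + h(x̄))·Kᵀ∂f(Kx̄); moreover θ̄ = (g(x̄) + h(x̄))/f(Kx̄) for every such accumulation point x̄. -/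
open Filter Metric Set RealInnerProductSpace
open scoped Topology Classical

noncomputable section

section ConvexSeparation

variable {E : Type*} [AddCommGroup E] [Module ℝ E]

/-- **Farkas' lemma** for finitely many linear functionals. -/
theorem exists_nonneg_sum_eq_of_nonpos_imp {ι : Type*} (s : Finset ι) (a : ι → E →ₗ[ℝ] ℝ)
    (ℓ : E →ₗ[ℝ] ℝ) (hℓ : ∀ v, (∀ i ∈ s, a i v ≤ 0) → ℓ v ≤ 0) :
    ∃ c : ι → ℝ, (∀ i ∈ s, 0 ≤ c i) ∧ ℓ = ∑ i ∈ s, c i • a i := by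
  induction s using Finset.induction_on generalizing a ℓ with
  | empty =>
    refine ⟨fun _ => 0, by simp, ?_⟩
    ext v
    have h1 := hℓ v (by simp)
    have h2 := hℓ (-v) (by simp)
    simp only [map_neg] at h2
    simp only [Finset.sum_empty, LinearMap.zero_apply]
    linarith
  | insert j s hj ih =>
    by_cases hs : ∀ v, (∀ i ∈ s, a i v ≤ 0) → ℓ v ≤ 0
    · obtain ⟨c, hc, hce⟩ := ih a ℓ hs
      refine ⟨fun i => if i = j then 0 else c i, ?_, ?_⟩
      · intro i hi
        by_cases hij : i = j
        · simp [hij]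
        · simpa [hij] using hc i (Finset.mem_of_mem_insert_of_ne hi hij)
      · rw [Finset.sum_insert hj, hce]
        simp only [if_true, zero_smul, zero_add]
        refine Finset.sum_congr rfl fun i hi => ?_
        rw [if_neg (ne_of_mem_of_not_mem hi hj)]
    · push Not at hs
      obtain ⟨v, hv, hℓv⟩ := hs
      have hjv : 0 < a j v := by
        by_contra hcon
        refine absurd (hℓ v fun i hi => ?_) (not_le.2 hℓv)
        rcases Finset.mem_insert.1 hi with rfl | hi
        · exact not_lt.1 hcon
        · exact hv i hi
      obtain ⟨c, hc, hce⟩ := ih (fun i => a i - (a i v / a j v) • a j)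
        (ℓ - (ℓ v / a j v) • a j) (by
          intro w hw
          have := hℓ (w - (a j w / a j v) • v) (by
            intro i hi
            rcases Finset.mem_insert.1 hi with rfl | hi
            · simp only [map_sub, map_smul, smul_eq_mul]
              field_simp
              simp
            · have := hw i hi
              simp only [LinearMap.sub_apply, LinearMap.smul_apply, smul_eq_mul] at this
              simp only [map_sub, map_smul, smul_eq_mul]
              convert this using 1
              ring)
          simp only [map_sub, map_smul, smul_eq_mul] at this
          simp only [LinearMap.sub_apply, LinearMap.smul_apply, smul_eq_mul]
          convert this using 1
          ring)
      refine ⟨fun i => if i = j then (ℓ v - ∑ k ∈ s, c k * a k v) / a j v else c i, ?_, ?_⟩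
      · intro i hi
        by_cases hij : i = j
        · simp only [hij, if_true]
          have : ∑ k ∈ s, c k * a k v ≤ 0 :=
            Finset.sum_nonpos fun k hk => mul_nonpos_of_nonneg_of_nonpos (hc k hk) (hv k hk)
          exact div_nonneg (by linarith) hjv.le
        · simpa [hij] using hc i (Finset.mem_of_mem_insert_of_ne hi hij)
      · rw [Finset.sum_insert hj]
        simp only [if_true]
        have hsum : ∑ i ∈ s, (if i = j then (ℓ v - ∑ k ∈ s, c k * a k v) / a j v else c i) • a i
            = ∑ i ∈ s, c i • a i :=
          Finset.sum_congr rfl fun i hi => by rw [if_neg (ne_of_mem_of_not_mem hi hj)]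
        rw [hsum]
        ext w
        have hw := LinearMap.congr_fun hce w
        simp only [LinearMap.sub_apply, LinearMap.smul_apply, LinearMap.sum_apply, smul_eq_mul,
          mul_sub, Finset.sum_sub_distrib] at hw
        have hfac : ∑ i ∈ s, c i * (a i v / a j v * a j w)
            = (∑ i ∈ s, c i * a i v) * (a j w / a j v) := by
          rw [Finset.sum_mul]
          exact Finset.sum_congr rfl fun i _ => by ring
        rw [hfac] at hw
        simp only [LinearMap.add_apply, LinearMap.smul_apply, LinearMap.sum_apply, smul_eq_mul]
        have : ℓ w = ∑ i ∈ s, c i * a i w - (∑ i ∈ s, c i * a i v) * (a j w / a j v)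
          + ℓ v / a j v * a j w := by linarith
        rw [this]
        ring

/-- A convex function that is nonnegative on a convex set, both touching at the origin, can be
separated from that set by a linear functional, provided the difference of the two sets absorbs
a subspace containing both. -/
theorem exists_linearMap_le_and_nonneg {C S : Set E} {G : E → ℝ} (hG : ConvexOn ℝ C G)
    (hS : Convex ℝ S) (h0C : (0 : E) ∈ C) (h0S : (0 : E) ∈ S) (hG0 : G 0 = 0)
    (hnn : ∀ z ∈ C, z ∈ S → 0 ≤ G z) (V : Submodule ℝ E)
    (hCV : ∀ z ∈ C, z ∈ V) (hSV : ∀ z ∈ S, z ∈ V)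
    (hV : ∀ v ∈ V, ∃ ε : ℝ, 0 < ε ∧ ∃ w ∈ C, ∃ s ∈ S, ε • v = w - s) :
    ∃ ℓ : E →ₗ[ℝ] ℝ, (∀ w ∈ C, ℓ w ≤ G w) ∧ ∀ s ∈ S, 0 ≤ ℓ s := by
  let T : PointedCone ℝ (V × ℝ) :=
    { carrier := {q | ∃ ε : ℝ, 0 < ε ∧ ∃ w ∈ C, ∃ s ∈ S, ε • (q.1 : E) = w - s ∧ G w ≤ ε * q.2}
      zero_mem' := ⟨1, one_pos, 0, h0C, 0, h0S, by simp, by simp [hG0]⟩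
      add_mem' := by
        rintro ⟨v₁, r₁⟩ ⟨v₂, r₂⟩ ⟨ε₁, hε₁, w₁, hw₁, s₁, hs₁, he₁, hr₁⟩
          ⟨ε₂, hε₂, w₂, hw₂, s₂, hs₂, he₂, hr₂⟩
        have hpos : 0 < ε₁ + ε₂ := by positivity
        have ha : 0 ≤ ε₂ / (ε₁ + ε₂) := by positivity
        have hb : 0 ≤ ε₁ / (ε₁ + ε₂) := by positivity
        have hab : ε₂ / (ε₁ + ε₂) + ε₁ / (ε₁ + ε₂) = 1 := by field_simp; ring
        refine ⟨ε₁ * ε₂ / (ε₁ + ε₂), by positivity,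
          (ε₂ / (ε₁ + ε₂)) • w₁ + (ε₁ / (ε₁ + ε₂)) • w₂, hG.1 hw₁ hw₂ ha hb hab,
          (ε₂ / (ε₁ + ε₂)) • s₁ + (ε₁ / (ε₁ + ε₂)) • s₂, hS hs₁ hs₂ ha hb hab, ?_, ?_⟩
        · have hw₁' : w₁ = ε₁ • (v₁ : E) + s₁ := by
            rw [show ε₁ • (v₁ : E) = w₁ - s₁ from he₁]; abel
          have hw₂' : w₂ = ε₂ • (v₂ : E) + s₂ := by
            rw [show ε₂ • (v₂ : E) = w₂ - s₂ from he₂]; abel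
          simp only [Prod.mk_add_mk, Submodule.coe_add]
          rw [hw₁', hw₂']
          module
        · have h1 := hG.2 hw₁ hw₂ ha hb hab
          simp only [smul_eq_mul] at h1
          simp only [Prod.mk_add_mk]
          have h2 := mul_le_mul_of_nonneg_left hr₁ ha
          have h3 := mul_le_mul_of_nonneg_left hr₂ hb
          simp only at h2 h3
          calc _ ≤ _ := h1
            _ ≤ ε₂ / (ε₁ + ε₂) * (ε₁ * r₁) + ε₁ / (ε₁ + ε₂) * (ε₂ * r₂) := add_le_add h2 h3
            _ = _ := by ring
      smul_mem' := by
        rintro ⟨c, hc⟩ ⟨v, r⟩ ⟨ε, hε, w, hw, s, hs, he, hr⟩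
        rcases hc.eq_or_lt with h0 | hc'
        · subst h0
          refine ⟨1, one_pos, 0, h0C, 0, h0S, ?_, ?_⟩ <;> simp [hG0, Nonneg.mk_smul]
        · refine ⟨ε / c, by positivity, w, hw, s, hs, ?_, ?_⟩
          · rw [← he]
            simp only [Prod.smul_mk, Nonneg.mk_smul, Submodule.coe_smul, smul_smul]
            congr 1
            field_simp
          · refine hr.trans_eq ?_
            simp only [Prod.smul_mk, Nonneg.mk_smul, smul_eq_mul]
            field_simp }
  have memT : ∀ q : V × ℝ, q ∈ T ↔
      ∃ ε : ℝ, 0 < ε ∧ ∃ w ∈ C, ∃ s ∈ S, ε • (q.1 : E) = w - s ∧ G w ≤ ε * q.2 := fun _ => Iff.rfl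
  let F : (V × ℝ) →ₗ.[ℝ] ℝ :=
    { domain := Submodule.prod ⊥ ⊤
      toFun := (LinearMap.snd ℝ V ℝ).comp (Submodule.subtype _) }
  obtain ⟨k, hk, hkT⟩ := riesz_extension T F (by
      rintro ⟨⟨v, r⟩, hq⟩ hT
      obtain ⟨ε, hε, w, hw, s, hs, he, hr⟩ := (memT _).1 hT
      have hv : v = 0 := (Submodule.mem_prod.1 hq).1
      subst hv
      have hws : w = s := by
        rw [← sub_eq_zero, ← he]; simp
      subst hws
      have h1 : 0 ≤ ε * r := (hnn w hw hs).trans hr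
      exact nonneg_of_mul_nonneg_right h1 hε) (by
      rintro ⟨v, r⟩
      obtain ⟨ε, hε, w, hw, s, hs, he⟩ := hV v v.2
      refine ⟨⟨(0, G w / ε - r), by simp [F]⟩, (memT _).2 ⟨ε, hε, w, hw, s, hs, ?_, ?_⟩⟩
      · simpa using he
      · simp only [Prod.mk_add_mk, sub_add_cancel]
        rw [mul_div_cancel₀ _ hε.ne'])
  have hk' : ∀ r : ℝ, k (0, r) = r := fun r => hk ⟨(0, r), by simp [F]⟩
  obtain ⟨ℓ, hℓ⟩ := LinearMap.exists_extend (-(k.comp (LinearMap.inl ℝ V ℝ)))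
  have hℓV : ∀ v : V, ℓ v = -k (v, 0) := fun v => LinearMap.congr_fun hℓ v
  have key : ∀ w ∈ C, ∀ s ∈ S, ℓ (w - s) ≤ G w := by
    intro w hw s hs
    have hmem : w - s ∈ V := V.sub_mem (hCV w hw) (hSV s hs)
    have h1 := hkT (⟨w - s, hmem⟩, G w) ((memT _).2 ⟨1, one_pos, w, hw, s, hs, by simp, by simp⟩)
    have h2 : k (⟨w - s, hmem⟩, G w) = k (⟨w - s, hmem⟩, 0) + k (0, G w) := by
      rw [← map_add]; simp
    have h3 := hℓV ⟨w - s, hmem⟩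
    rw [h2, hk'] at h1
    simp only at h3
    linarith
  refine ⟨ℓ, fun w hw => by simpa using key w hw 0 h0S, fun s hs => ?_⟩
  have := key 0 h0C s hs
  simp only [zero_sub, map_neg, hG0] at this
  linarith

end ConvexSeparation

section ExtendedRealConvex

theorem coe_toReal_of_mem_edom {α : Type*} {f : α → EReal} (hf : ERealProper f) {z : α}
    (hz : z ∈ edom f) : ((f z).toReal : EReal) = f z :=
  EReal.coe_toReal hz (hf.1 z)

/-- An extended-real-valued proper convex function is convex on its effective domain. -/
theorem ERealConvex.convexOn_toReal {α : Type*} [AddCommGroup α] [Module ℝ α] {f : α → EReal}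
    (hf : ERealConvex f) (hP : ERealProper f) :
    ConvexOn ℝ (edom f) fun z => (f z).toReal := by
  have key : ∀ ⦃x⦄, x ∈ edom f → ∀ ⦃y⦄, y ∈ edom f → ∀ ⦃a b : ℝ⦄, 0 ≤ a → 0 ≤ b → a + b = 1 →
      f (a • x + b • y) ≤ ((a * (f x).toReal + b * (f y).toReal : ℝ) : EReal) := by
    intro x hx y hy a b ha hb hab
    have := hf x y a b ha hb hab
    rwa [← coe_toReal_of_mem_edom hP hx, ← coe_toReal_of_mem_edom hP hy, ← EReal.coe_mul,
      ← EReal.coe_mul, ← EReal.coe_add] at this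
  have hconv : Convex ℝ (edom f) := fun x hx y hy a b ha hb hab =>
    ((key hx hy ha hb hab).trans_lt (EReal.coe_lt_top _)).ne
  refine ⟨hconv, fun x hx y hy a b ha hb hab => ?_⟩
  have h1 := key hx hy ha hb hab
  rw [← coe_toReal_of_mem_edom hP (hconv hx hy ha hb hab)] at h1
  simpa using EReal.coe_le_coe_iff.1 h1

/-- A lower semicontinuous function inherits upper bounds along convergent sequences. -/
theorem le_of_tendsto_of_lowerSemicontinuous {α : Type*} [TopologicalSpace α] {g : α → EReal}
    (hg : LowerSemicontinuous g) {x : ℕ → α} {a : α} {r : ℕ → ℝ} {s : ℝ}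
    (hx : Tendsto x atTop (𝓝 a)) (hr : Tendsto r atTop (𝓝 s)) (hle : ∀ j, g (x j) ≤ r j) :
    g a ≤ s := by
  have hT : Tendsto (fun j => (x j, (r j : EReal))) atTop (𝓝 (a, (s : EReal))) :=
    hx.prodMk_nhds ((continuous_coe_real_ereal.tendsto s).comp hr)
  exact hg.isClosed_epigraph.mem_of_tendsto hT (Eventually.of_forall hle)

variable {E : Type*} [NormedAddCommGroup E] [InnerProductSpace ℝ E]

theorem toReal_add_inner_le_of_mem_csubdiff {f : E → EReal} (hP : ERealProper f) {z v w : E}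
    (hz : z ∈ edom f) (hw : w ∈ edom f) (hv : v ∈ csubdiff f z) :
    (f z).toReal + ⟪v, w - z⟫ ≤ (f w).toReal := by
  have := hv w
  rwa [← coe_toReal_of_mem_edom hP hz, ← coe_toReal_of_mem_edom hP hw, ← EReal.coe_add,
    EReal.coe_le_coe_iff] at this

theorem mem_csubdiff_of_toReal_le {f : E → EReal} (hP : ERealProper f) {z v : E}
    (hz : z ∈ edom f) (hv : ∀ w ∈ edom f, (f z).toReal + ⟪v, w - z⟫ ≤ (f w).toReal) :
    v ∈ csubdiff f z := by
  intro w
  by_cases hw : w ∈ edom f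
  · rw [← coe_toReal_of_mem_edom hP hz, ← coe_toReal_of_mem_edom hP hw, ← EReal.coe_add,
      EReal.coe_le_coe_iff]
    exact hv w hw
  · rw [show f w = ⊤ from not_not.1 hw]
    exact le_top

/-- From a relative interior point one can move in every direction of the affine hull. -/
theorem eventually_add_smul_mem_of_mem_intrinsicInterior {s : Set E} {x v : E}
    (hx : x ∈ intrinsicInterior ℝ s) (hv : v ∈ (affineSpan ℝ s).direction) :
    ∀ᶠ t in 𝓝 (0 : ℝ), x + t • v ∈ s := by
  obtain ⟨y, hy, rfl⟩ := mem_intrinsicInterior.1 hx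
  let c : ℝ → affineSpan ℝ s := fun t =>
    ⟨(t • v) +ᵥ (y : E), AffineSubspace.vadd_mem_of_mem_direction
      (Submodule.smul_mem _ t hv) y.2⟩
  have hc : Continuous c := by
    refine Continuous.subtype_mk ?_ _
    simp only [vadd_eq_add]
    fun_prop
  have hc0 : c 0 = y := by
    ext1
    simp [c]
  have hmem : interior ((↑) ⁻¹' s : Set (affineSpan ℝ s)) ∈ 𝓝 (c 0) := by
    rw [hc0]
    exact isOpen_interior.mem_nhds hy
  filter_upwards [hc.continuousAt.preimage_mem_nhds hmem] with t ht
  have := interior_subset ht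
  simpa [c, add_comm] using this

/-- A linear functional that is nonnegative on the part of a polyhedron (centred at one of its
points) lying in a subspace agrees on that subspace with one that is nonnegative on the whole
polyhedron. -/
theorem IsPolyhedral.exists_linearMap_nonneg {S : Set E} (hS : IsPolyhedral S) {z : E}
    (hz : z ∈ S) (V : Submodule ℝ E) (ℓ : E →ₗ[ℝ] ℝ)
    (hℓ : ∀ v ∈ V, z + v ∈ S → 0 ≤ ℓ v) :
    ∃ ℓ' : E →ₗ[ℝ] ℝ, (∀ v ∈ V, ℓ' v = ℓ v) ∧ ∀ v, z + v ∈ S → 0 ≤ ℓ' v := by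
  obtain ⟨m, a, b, rfl⟩ := hS
  simp only [mem_ofPred_eq] at hz hℓ
  let I : Finset (Fin m) := Finset.univ.filter fun i => ⟪a i, z⟫ = b i
  obtain ⟨c, hc, hce⟩ := exists_nonneg_sum_eq_of_nonpos_imp I
    (fun i => (innerₛₗ ℝ (a i)).comp V.subtype) (-(ℓ.comp V.subtype)) (by
      intro v hv
      have hev : ∀ᶠ t in 𝓝[>] (0 : ℝ), ∀ i, ⟪a i, z + t • (v : E)⟫ ≤ b i := by
        refine eventually_all.2 fun i => ?_
        by_cases hi : ⟪a i, z⟫ = b i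
        · filter_upwards [self_mem_nhdsWithin] with t ht
          have h1 : ⟪a i, (v : E)⟫ ≤ 0 := hv i (by simp [I, hi])
          rw [inner_add_right, inner_smul_right, hi]
          have := mul_nonpos_of_nonneg_of_nonpos (le_of_lt ht) h1
          linarith
        · have hcont : Continuous fun t : ℝ => ⟪a i, z + t • (v : E)⟫ := by fun_prop
          have h0 : ⟪a i, z + (0 : ℝ) • (v : E)⟫ < b i := by
            simpa using lt_of_le_of_ne (hz i) hi
          exact nhdsWithin_le_nhds
            ((hcont.continuousAt.eventually_lt_const h0).mono fun t ht => ht.le)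
      obtain ⟨t, ht, ht0⟩ := (hev.and self_mem_nhdsWithin).exists
      have h2 := hℓ (t • (v : E)) (V.smul_mem t v.2) ht
      rw [map_smul, smul_eq_mul] at h2
      have h3 := nonneg_of_mul_nonneg_right h2 ht0
      simpa using h3)
  refine ⟨-∑ i ∈ I, c i • innerₛₗ ℝ (a i), fun v hv => ?_, fun v hv => ?_⟩
  · have := LinearMap.congr_fun hce ⟨v, hv⟩
    simp only [LinearMap.neg_apply, LinearMap.comp_apply, Submodule.subtype_apply,
      LinearMap.sum_apply, LinearMap.smul_apply] at this
    simp only [LinearMap.neg_apply, LinearMap.sum_apply, LinearMap.smul_apply]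
    rw [← this, neg_neg]
  · simp only [LinearMap.neg_apply, LinearMap.sum_apply, LinearMap.smul_apply, smul_eq_mul,
      innerₛₗ_apply_apply]
    refine neg_nonneg.2 (Finset.sum_nonpos fun i hi => ?_)
    have h1 : ⟪a i, z⟫ = b i := by simpa [I] using hi
    have h2 : ⟪a i, z + v⟫ ≤ b i := hv i
    rw [inner_add_right, h1] at h2
    exact mul_nonpos_of_nonneg_of_nonpos (hc i hi) (by linarith)

/-- Sum rule for the subdifferential of `g + ι_S`: a minimizer over `S` of a convex function plus a
linear term satisfies the first-order condition with separate subgradients, under the usual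
relative interior qualification. -/
theorem exists_mem_csubdiff_mem_normalCone [FiniteDimensional ℝ E] {S : Set E} {g : E → EReal}
    (hS : Convex ℝ S) (hgP : ERealProper g) (hg : ERealConvex g)
    (hQ : (intrinsicInterior ℝ S ∩ intrinsicInterior ℝ (edom g)).Nonempty ∨
      (IsPolyhedral S ∧ (S ∩ intrinsicInterior ℝ (edom g)).Nonempty))
    {z q : E} (hz : z ∈ S) (hgz : z ∈ edom g)
    (hmin : ∀ w ∈ S, w ∈ edom g → (g z).toReal ≤ (g w).toReal + ⟪q, w - z⟫) :
    ∃ v ∈ csubdiff g z, ∃ w ∈ normalCone S z, v + q + w = 0 := by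
  have hconv := hg.convexOn_toReal hgP
  let C : Set E := {d | z + d ∈ edom g}
  let G : E → ℝ := fun d => (g (z + d)).toReal + (⟪q, d⟫ - (g z).toReal)
  have hA : ∀ (a b : ℝ) (d e : E), a + b = 1 →
      z + (a • d + b • e) = a • (z + d) + b • (z + e) := by
    intro a b d e hab
    have : z = (a + b) • z := by rw [hab, one_smul]
    nth_rewrite 1 [this]
    module
  have hG : ConvexOn ℝ C G := by
    refine ⟨fun d hd e he a b ha hb hab => ?_, fun d hd e he a b ha hb hab => ?_⟩
    · simp only [C, mem_ofPred_eq, hA a b d e hab]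
      exact hconv.1 hd he ha hb hab
    · have h1 := hconv.2 hd he ha hb hab
      simp only [G, hA a b d e hab, inner_add_right, inner_smul_right, smul_eq_mul] at h1 ⊢
      have : (g z).toReal = (a + b) * (g z).toReal := by rw [hab, one_mul]
      nlinarith
  have hG0 : G 0 = 0 := by simp [G]
  have h0C : (0 : E) ∈ C := by simpa [C] using hgz
  set VG := (affineSpan ℝ (edom g)).direction with hVG
  have hdir : ∀ {B : Set E} {w v : E}, w ∈ B → v ∈ B → w - v ∈ (affineSpan ℝ B).direction :=
    fun hw hv => AffineSubspace.vsub_mem_direction (subset_affineSpan ℝ _ hw)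
      (subset_affineSpan ℝ _ hv)
  have hCV : ∀ d ∈ C, d ∈ VG := fun d hd => by
    simpa using hdir (show z + d ∈ edom g from hd) hgz
  have hSd : Convex ℝ {d | z + d ∈ S} := by
    intro d hd e he a b ha hb hab
    simp only [mem_ofPred_eq, hA a b d e hab]
    exact hS hd he ha hb hab
  have hnn : ∀ d ∈ C, z + d ∈ S → 0 ≤ G d := by
    intro d hd hdS
    have := hmin _ hdS hd
    rw [add_sub_cancel_left] at this
    simp only [G]
    linarith
  have hsep : ∃ ℓ : E →ₗ[ℝ] ℝ, (∀ d ∈ C, ℓ d ≤ G d) ∧ ∀ d, z + d ∈ S → 0 ≤ ℓ d := by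
    rcases hQ with ⟨x, hxS, hxg⟩ | ⟨hpoly, x, hxS, hxg⟩
    · refine exists_linearMap_le_and_nonneg hG hSd h0C (show z + 0 ∈ S by simpa using hz) hG0 hnn
        (VG ⊔ (affineSpan ℝ S).direction) (fun d hd => Submodule.mem_sup_left (hCV d hd))
        (fun d hd => Submodule.mem_sup_right (by
          simpa using hdir (show z + d ∈ S from hd) hz)) fun v hv => ?_
      obtain ⟨v₁, hv₁, v₂, hv₂, rfl⟩ := Submodule.mem_sup.1 hv
      have e1 := eventually_add_smul_mem_of_mem_intrinsicInterior hxg hv₁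
      have e2 := eventually_add_smul_mem_of_mem_intrinsicInterior hxS (Submodule.neg_mem _ hv₂)
      obtain ⟨t, ⟨ht1, ht2⟩, ht0⟩ :=
        (((e1.and e2).filter_mono (nhdsWithin_le_nhds (s := Ioi 0))).and self_mem_nhdsWithin).exists
      refine ⟨t, ht0, x + t • v₁ - z, by simpa [C] using ht1, x + t • (-v₂) - z,
        show z + (x + t • (-v₂) - z) ∈ S by simpa using ht2, by module⟩
    · obtain ⟨ℓ, hℓC, hℓS⟩ := exists_linearMap_le_and_nonneg hG
        (hSd.inter VG.convex) h0C ⟨show z + 0 ∈ S by simpa using hz, VG.zero_mem⟩ hG0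
        (fun d hd hdS => hnn d hd hdS.1) VG hCV (fun d hd => hd.2) fun v hv => by
          obtain ⟨t, ht, ht0⟩ := (((eventually_add_smul_mem_of_mem_intrinsicInterior hxg
            hv).filter_mono (nhdsWithin_le_nhds (s := Ioi 0))).and self_mem_nhdsWithin).exists
          exact ⟨t, ht0, x + t • v - z, by simpa [C] using ht, x - z,
            ⟨show z + (x - z) ∈ S by simpa using hxS, hdir (intrinsicInterior_subset hxg) hgz⟩, by module⟩
      obtain ⟨ℓ', hℓV, hℓ'S⟩ := hpoly.exists_linearMap_nonneg hz VG ℓ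
        fun v hv hvS => hℓS v ⟨hvS, hv⟩
      exact ⟨ℓ', fun d hd => (hℓV d (hCV d hd)).trans_le (hℓC d hd), hℓ'S⟩
  obtain ⟨ℓ, hℓC, hℓS⟩ := hsep
  let r : E := (InnerProductSpace.toDual ℝ E).symm (LinearMap.toContinuousLinearMap ℓ)
  have hr : ∀ d, ⟪r, d⟫ = ℓ d := fun d => by simp [r]
  refine ⟨r - q, mem_csubdiff_of_toReal_le hgP hgz fun w hw => ?_, -r, fun w hw => ?_, by abel⟩
  · have := hℓC (w - z) (by simpa [C] using hw)
    simp only [G, add_sub_cancel] at this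
    rw [inner_sub_left, hr]
    linarith
  · have := hℓS (w - z) (by simpa using hw)
    rw [inner_neg_left, hr]
    linarith

end ExtendedRealConvex

section FirstOrder

variable {E : Type*} [NormedAddCommGroup E] [InnerProductSpace ℝ E]

/-- The descent lemma for a function with Lipschitz gradient on a convex set. -/
theorem le_add_inner_add_sq_of_gradient_lipschitz [CompleteSpace E] {h : E → ℝ} {gh : E → E}
    {S : Set E} {L : ℝ} (hS : Convex ℝ S) (hgrad : ∀ z ∈ S, HasGradientAt h (gh z) z)
    (hLip : ∀ z ∈ S, ∀ w ∈ S, ‖gh z - gh w‖ ≤ L * ‖z - w‖) {a b : E} (ha : a ∈ S) (hb : b ∈ S) :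
    h b ≤ h a + ⟪gh a, b - a⟫ + L / 2 * ‖b - a‖ ^ 2 := by
  have hmem : ∀ t ∈ Icc (0 : ℝ) 1, a + t • (b - a) ∈ S := fun t ht =>
    hS.add_smul_sub_mem ha hb ht
  let ψ : ℝ → ℝ := fun t => h (a + t • (b - a)) - t * ⟪gh a, b - a⟫ - L / 2 * ‖b - a‖ ^ 2 * t ^ 2
  have hψ : ∀ t ∈ Icc (0 : ℝ) 1, HasDerivAt ψ
      (⟪gh (a + t • (b - a)), b - a⟫ - ⟪gh a, b - a⟫ - L * ‖b - a‖ ^ 2 * t) t := by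
    intro t ht
    have hline : HasDerivAt (fun t : ℝ => a + t • (b - a)) (b - a) t := by
      simpa using ((hasDerivAt_id t).smul_const (b - a)).const_add a
    have h1 := (hgrad _ (hmem t ht)).hasFDerivAt.comp_hasDerivAt t hline
    have h2 := (h1.sub ((hasDerivAt_id t).mul_const ⟪gh a, b - a⟫)).sub
      ((hasDerivAt_pow 2 t).const_mul (L / 2 * ‖b - a‖ ^ 2))
    refine h2.congr_deriv ?_
    simp
    ring
  have hanti : AntitoneOn ψ (Icc 0 1) := by
    refine antitoneOn_of_hasDerivWithinAt_nonpos (convex_Icc 0 1)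
      (fun t ht => (hψ t ht).continuousAt.continuousWithinAt)
      (fun t ht => (hψ t (interior_subset ht)).hasDerivWithinAt) fun t ht => ?_
    have ht' := interior_subset ht
    rw [← inner_sub_left]
    have h1 := real_inner_le_norm (gh (a + t • (b - a)) - gh a) (b - a)
    have h2 := hLip _ (hmem t ht') a ha
    rw [add_sub_cancel_left, norm_smul, Real.norm_of_nonneg ht'.1] at h2
    have h3 := mul_le_mul_of_nonneg_right h2 (norm_nonneg (b - a))
    nlinarith
  have := hanti (left_mem_Icc.2 zero_le_one) (right_mem_Icc.2 zero_le_one) zero_le_one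
  simp only [ψ, one_smul, zero_smul, add_sub_cancel, add_zero] at this
  linarith

/-- First-order optimality inequality for a proximal step. -/
theorem toReal_le_add_inner_of_forall_le {S : Set E} {g : E → EReal} (hS : Convex ℝ S)
    (hgP : ERealProper g) (hg : ERealConvex g) {α : ℝ} {p e : E} (hp : p ∈ S) (hpg : p ∈ edom g)
    (hmin : ∀ w ∈ S, g p + ((α * ‖p + e‖ ^ 2 : ℝ) : EReal)
      ≤ g w + ((α * ‖w + e‖ ^ 2 : ℝ) : EReal))
    {w : E} (hw : w ∈ S) (hwg : w ∈ edom g) :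
    (g p).toReal ≤ (g w).toReal + 2 * α * ⟪p + e, w - p⟫ := by
  have hconv := hg.convexOn_toReal hgP
  have hstep : ∀ t ∈ Ioc (0 : ℝ) 1, (g p).toReal ≤
      (g w).toReal + 2 * α * ⟪p + e, w - p⟫ + α * ‖w - p‖ ^ 2 * t := by
    rintro t ⟨ht0, ht1⟩
    have hcomb : (1 - t) • p + t • w = p + t • (w - p) := by module
    have hdom := hconv.1 hpg hwg (sub_nonneg.2 ht1) ht0.le (sub_add_cancel 1 t)
    have h1 := hmin _ (hS hp hw (sub_nonneg.2 ht1) ht0.le (sub_add_cancel 1 t))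
    have h2 := hconv.2 hpg hwg (sub_nonneg.2 ht1) ht0.le (sub_add_cancel 1 t)
    rw [← coe_toReal_of_mem_edom hgP hpg, ← coe_toReal_of_mem_edom hgP hdom, ← EReal.coe_add,
      ← EReal.coe_add, EReal.coe_le_coe_iff] at h1
    simp only [smul_eq_mul] at h2
    have h3 : ‖(1 - t) • p + t • w + e‖ ^ 2
        = ‖p + e‖ ^ 2 + 2 * (t * ⟪p + e, w - p⟫) + t ^ 2 * ‖w - p‖ ^ 2 := by
      rw [show (1 - t) • p + t • w + e = (p + e) + t • (w - p) by module, norm_add_sq_real,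
        inner_smul_right, norm_smul, mul_pow, Real.norm_eq_abs, sq_abs]
    rw [h3] at h1
    have h4 : t * (g p).toReal ≤
        t * ((g w).toReal + 2 * α * ⟪p + e, w - p⟫ + α * ‖w - p‖ ^ 2 * t) := by nlinarith
    exact le_of_mul_le_mul_left h4 ht0
  have hlim : Tendsto (fun t : ℝ => (g w).toReal + 2 * α * ⟪p + e, w - p⟫ + α * ‖w - p‖ ^ 2 * t)
      (𝓝[>] 0) (𝓝 ((g w).toReal + 2 * α * ⟪p + e, w - p⟫)) := by
    have : Continuous fun t : ℝ =>
      (g w).toReal + 2 * α * ⟪p + e, w - p⟫ + α * ‖w - p‖ ^ 2 * t := by fun_prop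
    simpa using (this.tendsto 0).mono_left nhdsWithin_le_nhds
  refine ge_of_tendsto hlim ?_
  filter_upwards [Ioc_mem_nhdsGT one_pos] with t ht using hstep t ht

/-- Subgradients of a proper convex function are locally bounded on the interior of its domain. -/
theorem exists_bound_csubdiff_of_mem_interior [FiniteDimensional ℝ E] {f : E → EReal}
    (hP : ERealProper f) (hf : ERealConvex f) {z : E} (hz : z ∈ interior (edom f)) :
    ∃ R : ℝ, ∀ᶠ w in 𝓝 z, ∀ v ∈ csubdiff f w, ‖v‖ ≤ R := by
  have hcont : ContinuousAt (fun w => (f w).toReal) z :=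
    (hf.convexOn_toReal hP).continuousOn_interior.continuousAt (isOpen_interior.mem_nhds hz)
  have hev : ∀ᶠ w in 𝓝 z, w ∈ edom f ∧ |(f w).toReal - (f z).toReal| < 1 := by
    have hdom : ∀ᶠ w in 𝓝 z, w ∈ edom f := mem_interior_iff_mem_nhds.1 hz
    refine hdom.and ?_
    have := Metric.tendsto_nhds.1 hcont 1 one_pos
    simpa [Real.dist_eq] using this
  obtain ⟨r, hr, hball⟩ := Metric.eventually_nhds_iff_ball.1 hev
  refine ⟨2 / (r / 2), ?_⟩
  filter_upwards [Metric.ball_mem_nhds z (half_pos hr)] with w hw v hv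
  rcases eq_or_ne v 0 with rfl | hv0
  · rw [norm_zero]
    positivity
  have hvn : 0 < ‖v‖ := norm_pos_iff.2 hv0
  have hw' := hball w (Metric.ball_subset_ball (by linarith) hw)
  have hd : w + (r / 2 / ‖v‖) • v ∈ Metric.ball z r := by
    rw [mem_ball_iff_norm] at hw ⊢
    calc ‖w + (r / 2 / ‖v‖) • v - z‖ = ‖(w - z) + (r / 2 / ‖v‖) • v‖ := by congr 1; abel
      _ ≤ ‖w - z‖ + ‖(r / 2 / ‖v‖) • v‖ := norm_add_le _ _
      _ = ‖w - z‖ + r / 2 := by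
        rw [norm_smul, Real.norm_of_nonneg (by positivity), div_mul_cancel₀ _ hvn.ne']
      _ < r := by linarith
  have hd' := hball _ hd
  have h1 := toReal_add_inner_le_of_mem_csubdiff hP hw'.1 hd'.1 hv
  rw [add_sub_cancel_left, inner_smul_right, real_inner_self_eq_norm_sq] at h1
  have h2 : r / 2 / ‖v‖ * ‖v‖ ^ 2 = ‖v‖ * (r / 2) := by field_simp
  rw [h2] at h1
  rw [le_div_iff₀ (half_pos hr)]
  have h3 := abs_lt.1 hw'.2
  have h4 := abs_lt.1 hd'.2
  linarith [h3.1, h4.2]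

end FirstOrder

theorem tendsto_zero_of_mul_norm_sq_le {E : Type*} [NormedAddCommGroup E] {v : ℕ → E} {r : ℕ → ℝ} {c : ℝ}
    (hc : 0 < c) (hle : ∀ k, c * ‖v k‖ ^ 2 ≤ r k) (hr : Tendsto r atTop (𝓝 0)) : Tendsto v atTop (𝓝 0) := by
  rw [tendsto_zero_iff_norm_tendsto_zero]
  have hsq : Tendsto (fun k => ‖v k‖ ^ 2) atTop (𝓝 0) := by
    refine squeeze_zero (fun k => by positivity) (g := fun k => r k / c) (fun k => ?_) ?_
    · rw [le_div_iff₀ hc, mul_comm]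
      exact hle k
    · simpa using hr.div_const c
  have := (Real.continuous_sqrt.tendsto 0).comp hsq
  simpa [Function.comp_def, Real.sqrt_sq (norm_nonneg _)] using this


theorem stmt8 {n p : ℕ}
    (S : Set (EuclideanSpace ℝ (Fin n)))
    (g : EuclideanSpace ℝ (Fin n) → EReal)
    (h : EuclideanSpace ℝ (Fin n) → ℝ)
    (gh : EuclideanSpace ℝ (Fin n) → EuclideanSpace ℝ (Fin n))
    (f : EuclideanSpace ℝ (Fin p) → EReal)
    (K : EuclideanSpace ℝ (Fin n) →ₗ[ℝ] EuclideanSpace ℝ (Fin p))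
    (L δ : ℝ)
    (hS : S.Nonempty) (hSconv : Convex ℝ S) (hScomp : IsCompact S)
    (hgP : ERealProper g) (hgconv : ERealConvex g) (hglsc : LowerSemicontinuous g)
    (hfP : ERealProper f) (hfconv : ERealConvex f) (hflsc : LowerSemicontinuous f)
    (hL : 0 < L)
    (hhC1 : ∃ O : Set (EuclideanSpace ℝ (Fin n)), IsOpen O ∧ S ⊆ O ∧
      (∀ z ∈ O, HasGradientAt h (gh z) z) ∧
      (∀ z ∈ O, ∀ w ∈ O, ‖gh z - gh w‖ ≤ L * ‖z - w‖))
    (hKS : ∀ z ∈ S, K z ∈ interior (edom f))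
    (hfpos : ∀ z ∈ S, (0 : EReal) < f (K z))
    (hghnn : ∀ z ∈ S, (0 : EReal) ≤ g z + ((h z : ℝ) : EReal))
    (hSg : ∃ z ∈ S, g z ≠ ⊤)
    (hδ : 0 < δ) (hδL : δ < 1 / L)
    (σ : ℝ) (hσ : 0 < σ) (hσ2 : σ < 2)
    (x u : ℕ → EuclideanSpace ℝ (Fin n)) (y : ℕ → EuclideanSpace ℝ (Fin p)) (θ : ℕ → ℝ)
    (hxS : ∀ k, x k ∈ S ∧ g (x k) ≠ ⊤)
    (hy : ∀ k, y (k+1) ∈ csubdiff f (K (x k)))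
    (hxmin : ∀ k, ∀ w ∈ S,
      g (x (k+1)) + (((2*δ)⁻¹ * ‖x (k+1) - u k + δ • gh (x k)
          - (θ k * δ) • (LinearMap.adjoint K) (y (k+1))‖ ^ 2 : ℝ) : EReal)
        ≤ g w + (((2*δ)⁻¹ * ‖w - u k + δ • gh (x k)
          - (θ k * δ) • (LinearMap.adjoint K) (y (k+1))‖ ^ 2 : ℝ) : EReal))
    (hu : ∀ k, u (k+1) = (1 - σ) • u k + σ • x (k+1))
    (hθ : ∀ k, (θ k : EReal) = varthetaF S g h f K δ (x k) (u k))
    (hθnn : ∀ k, 0 ≤ θ k)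
    (hA2 : (intrinsicInterior ℝ S ∩ intrinsicInterior ℝ (edom g)).Nonempty ∨
      (IsPolyhedral S ∧ (S ∩ intrinsicInterior ℝ (edom g)).Nonempty))
    (θbar : ℝ) (hθlim : Tendsto θ atTop (𝓝 θbar))
    :
    ∀ xb : EuclideanSpace ℝ (Fin n),
      (∃ φ : ℕ → ℕ, StrictMono φ ∧ Tendsto (fun j => x (φ j)) atTop (𝓝 xb)) →
      (∃ v ∈ csubdiff g xb, ∃ w ∈ normalCone S xb, ∃ z ∈ csubdiff f (K xb),
          (f (K xb)).toReal • (v + gh xb + w)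
            - (g xb + ((h xb : ℝ) : EReal)).toReal • (LinearMap.adjoint K) z = 0)
      ∧ ((θbar : ℝ) : EReal) = (g xb + ((h xb : ℝ) : EReal)) / f (K xb) := by
  obtain ⟨O, hO, hSO, hgrad, hLip⟩ := hhC1
  have hxg : ∀ k, x k ∈ edom g := fun k => (hxS k).2
  have hfdom : ∀ z ∈ S, K z ∈ edom f := fun z hz => interior_subset (hKS z hz)
  have hFpos : ∀ z ∈ S, 0 < (f (K z)).toReal := fun z hz =>
    EReal.toReal_pos (hfpos z hz) (hfdom z hz)
  have hKcont : Continuous K := K.continuous_of_finiteDimensional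
  have hFcont : ∀ z ∈ S, ContinuousAt (fun w => (f (K w)).toReal) z := fun z hz =>
    ContinuousAt.comp (f := K) (g := fun w => (f w).toReal)
      ((hfconv.convexOn_toReal hfP).continuousOn_interior.continuousAt
        (isOpen_interior.mem_nhds (hKS z hz))) hKcont.continuousAt
  have hθeq : ∀ k, θ k * (f (K (x k))).toReal =
      (g (x k)).toReal + h (x k) + (2 * δ)⁻¹ * ‖x k - u k‖ ^ 2 := by
    intro k
    have h1 := hθ k
    simp only [varthetaF, phiF, if_pos (hxS k).1, add_zero] at h1
    rw [← coe_toReal_of_mem_edom hgP (hxg k), ← coe_toReal_of_mem_edom hfP (hfdom _ (hxS k).1),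
      ← EReal.coe_add, ← EReal.coe_add, ← EReal.coe_div, EReal.coe_eq_coe_iff] at h1
    rw [h1, div_mul_cancel₀ _ (hFpos _ (hxS k).1).ne']
  -- The variational inequality satisfied by each proximal step.
  have hVI : ∀ k, ∀ w ∈ S, w ∈ edom g → (g (x (k + 1))).toReal ≤ (g w).toReal
      + δ⁻¹ * ⟪x (k + 1) - u k, w - x (k + 1)⟫ + ⟪gh (x k), w - x (k + 1)⟫
      - θ k * ⟪y (k + 1), K (w - x (k + 1))⟫ := by
    intro k w hw hwg
    have h1 := toReal_le_add_inner_of_forall_le hSconv hgP hgconv (α := (2 * δ)⁻¹)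
      (e := -u k + δ • gh (x k) - (θ k * δ) • (LinearMap.adjoint K) (y (k + 1)))
      (hxS (k + 1)).1 (hxg (k + 1)) (fun w hw => by
        have := hxmin k w hw
        simp only [sub_eq_add_neg, add_assoc] at this ⊢
        exact this) hw hwg
    rw [show x (k + 1) + (-u k + δ • gh (x k) - (θ k * δ) • (LinearMap.adjoint K) (y (k + 1)))
        = (x (k + 1) - u k) + δ • gh (x k) - (θ k * δ) • (LinearMap.adjoint K) (y (k + 1)) by abel,
      inner_sub_left, inner_add_left, real_inner_smul_left, real_inner_smul_left,
      LinearMap.adjoint_inner_left] at h1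
    refine h1.trans_eq ?_
    field_simp
    ring
  have hB : 0 < (2 * δ)⁻¹ - L / 2 := by
    rw [lt_div_iff₀ hL] at hδL
    rw [sub_pos, lt_inv_comm₀ (by positivity) (by positivity), inv_div, lt_div_iff₀ hL]
    linarith
  have hA : 0 < σ * (2 - σ) * (2 * δ)⁻¹ :=
    mul_pos (mul_pos hσ (sub_pos.2 hσ2)) (by positivity)
  have hdescent : ∀ k, θ (k + 1) * (f (K (x (k + 1)))).toReal
      + σ * (2 - σ) * (2 * δ)⁻¹ * ‖x (k + 1) - u k‖ ^ 2
      + ((2 * δ)⁻¹ - L / 2) * ‖x (k + 1) - x k‖ ^ 2 ≤ θ k * (f (K (x (k + 1)))).toReal := by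
    intro k
    have h1 := hVI k (x k) (hxS k).1 (hxg k)
    have h2 := le_add_inner_add_sq_of_gradient_lipschitz hSconv (fun z hz => hgrad z (hSO hz))
      (fun z hz w hw => hLip z (hSO hz) w (hSO hw)) (hxS k).1 (hxS (k + 1)).1
    have h3 := toReal_add_inner_le_of_mem_csubdiff hfP (hfdom _ (hxS k).1)
      (hfdom _ (hxS (k + 1)).1) (hy k)
    have h4 : x (k + 1) - u (k + 1) = (1 - σ) • (x (k + 1) - u k) := by
      rw [hu k]
      module
    have h5 := hθeq (k + 1)
    rw [h4, norm_smul, mul_pow, Real.norm_eq_abs, sq_abs] at h5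
    have h6 := hθeq k
    have h7 : ‖x k - u k‖ ^ 2 = ‖x (k + 1) - u k‖ ^ 2 + 2 * ⟪x (k + 1) - u k, x k - x (k + 1)⟫
        + ‖x (k + 1) - x k‖ ^ 2 := by
      rw [norm_sub_rev (x (k + 1)) (x k), ← norm_add_sq_real]
      congr 2
      abel
    rw [h7] at h6
    rw [← neg_sub (x (k + 1)) (x k), map_neg, inner_neg_right (gh (x k)),
      inner_neg_right (y (k + 1)), map_sub] at h1
    have h8 := mul_le_mul_of_nonneg_left h3 (hθnn k)
    have h9 : δ⁻¹ = 2 * (2 * δ)⁻¹ := by field_simp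
    rw [h9, neg_sub] at h1
    nlinarith
  obtain ⟨M, hM⟩ : ∃ M, ∀ z ∈ S, (f (K z)).toReal ≤ M := by
    obtain ⟨M, hM⟩ := hScomp.bddAbove_image (f := fun w => (f (K w)).toReal)
      fun z hz => (hFcont z hz).continuousWithinAt
    exact ⟨M, fun z hz => hM (mem_image_of_mem _ hz)⟩
  have hgap : ∀ k, σ * (2 - σ) * (2 * δ)⁻¹ * ‖x (k + 1) - u k‖ ^ 2
      + ((2 * δ)⁻¹ - L / 2) * ‖x (k + 1) - x k‖ ^ 2 ≤ (θ k - θ (k + 1)) * M := by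
    intro k
    have h1 := hdescent k
    have h2 : 0 ≤ σ * (2 - σ) * (2 * δ)⁻¹ * ‖x (k + 1) - u k‖ ^ 2 := by positivity
    have h3 : 0 ≤ ((2 * δ)⁻¹ - L / 2) * ‖x (k + 1) - x k‖ ^ 2 := by positivity
    have hF := hFpos _ (hxS (k + 1)).1
    have h4 : 0 ≤ θ k - θ (k + 1) :=
      nonneg_of_mul_nonneg_left (by linarith : 0 ≤ (θ k - θ (k + 1)) * _) hF
    have h5 := mul_le_mul_of_nonneg_left (hM _ (hxS (k + 1)).1) h4
    linarith
  have hgap0 : Tendsto (fun k => (θ k - θ (k + 1)) * M) atTop (𝓝 0) := by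
    simpa using (hθlim.sub (hθlim.comp (tendsto_add_atTop_nat 1))).mul_const M
  have hxu : Tendsto (fun k => x (k + 1) - u k) atTop (𝓝 0) :=
    tendsto_zero_of_mul_norm_sq_le hA (fun k => by
      have : 0 ≤ ((2 * δ)⁻¹ - L / 2) * ‖x (k + 1) - x k‖ ^ 2 := by positivity
      linarith [hgap k]) hgap0
  have hxx : Tendsto (fun k => x (k + 1) - x k) atTop (𝓝 0) :=
    tendsto_zero_of_mul_norm_sq_le hB (fun k => by
      have : 0 ≤ σ * (2 - σ) * (2 * δ)⁻¹ * ‖x (k + 1) - u k‖ ^ 2 := by positivity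
      linarith [hgap k]) hgap0
  have hxu' : Tendsto (fun k => x (k + 1) - u (k + 1)) atTop (𝓝 0) := by
    have h1 : ∀ k, x (k + 1) - u (k + 1) = (1 - σ) • (x (k + 1) - u k) := fun k => by
      rw [hu k]
      module
    simpa [h1] using hxu.const_smul (1 - σ)
  rintro xb ⟨φ, hφ, hφlim⟩
  have hxb : xb ∈ S := hScomp.isClosed.mem_of_tendsto hφlim (Eventually.of_forall fun j => (hxS _).1)
  -- Extract a convergent subsequence of the dual variables.
  obtain ⟨R, hR⟩ := exists_bound_csubdiff_of_mem_interior hfP hfconv (hKS xb hxb)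
  have hybdd : ∀ᶠ j in atTop, y (φ j + 1) ∈ Metric.closedBall (0 : EuclideanSpace ℝ (Fin p)) R := by
    filter_upwards [((hKcont.tendsto xb).comp hφlim).eventually hR] with j hj
    simpa using hj _ (hy (φ j))
  obtain ⟨yb, -, τ, hτ, hylim⟩ :=
    tendsto_subseq_of_frequently_bounded Metric.isBounded_closedBall hybdd.frequently
  let κ : ℕ → ℕ := φ ∘ τ
  have hκ : Tendsto κ atTop atTop := (hφ.comp hτ).tendsto_atTop
  have hx0 : Tendsto (fun j => x (κ j)) atTop (𝓝 xb) := hφlim.comp hτ.tendsto_atTop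
  have hx1 : Tendsto (fun j => x (κ j + 1)) atTop (𝓝 xb) := by
    simpa using (hxx.comp hκ).add hx0
  have hy1 : Tendsto (fun j => y (κ j + 1)) atTop (𝓝 yb) := hylim
  have hθ0 : Tendsto (fun j => θ (κ j)) atTop (𝓝 θbar) := hθlim.comp hκ
  have hθ1 : Tendsto (fun j => θ (κ j + 1)) atTop (𝓝 θbar) :=
    hθlim.comp ((tendsto_add_atTop_nat 1).comp hκ)
  have hghlim : Tendsto (fun j => gh (x (κ j))) atTop (𝓝 (gh xb)) := by
    rw [tendsto_iff_norm_sub_tendsto_zero]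
    refine squeeze_zero (fun j => norm_nonneg _)
      (fun j => hLip _ (hSO (hxS (κ j)).1) _ (hSO hxb)) ?_
    simpa using (tendsto_iff_norm_sub_tendsto_zero.1 hx0).const_mul L
  have hyb : yb ∈ csubdiff f (K xb) := by
    refine mem_csubdiff_of_toReal_le hfP (hfdom xb hxb) fun w hw => ?_
    refine le_of_tendsto (((hFcont xb hxb).tendsto.comp hx0).add
      (hy1.inner (tendsto_const_nhds.sub ((hKcont.tendsto xb).comp hx0))))
      (Eventually.of_forall fun j => ?_)
    exact toReal_add_inner_le_of_mem_csubdiff hfP (hfdom _ (hxS _).1) hw (hy (κ j))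
  -- The values of `g` converge, since those of `θ` do.
  have hglim : Tendsto (fun j => (g (x (κ j + 1))).toReal) atTop
      (𝓝 (θbar * (f (K xb)).toReal - h xb)) := by
    have h1 : Tendsto (fun j => θ (κ j + 1) * (f (K (x (κ j + 1)))).toReal - h (x (κ j + 1))
        - (2 * δ)⁻¹ * ‖x (κ j + 1) - u (κ j + 1)‖ ^ 2) atTop
        (𝓝 (θbar * (f (K xb)).toReal - h xb - (2 * δ)⁻¹ * ‖(0 : EuclideanSpace ℝ (Fin n))‖ ^ 2)) :=
      ((hθ1.mul ((hFcont xb hxb).tendsto.comp hx1)).sub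
        ((hgrad xb (hSO hxb)).continuousAt.tendsto.comp hx1)).sub
        (((hxu'.comp hκ).norm.pow 2).const_mul _)
    simp only [norm_zero, ne_eq, OfNat.ofNat_ne_zero, not_false_eq_true, zero_pow, mul_zero,
      sub_zero] at h1
    refine h1.congr fun j => ?_
    rw [hθeq]
    ring
  have hgle : g xb ≤ ((θbar * (f (K xb)).toReal - h xb : ℝ) : EReal) :=
    le_of_tendsto_of_lowerSemicontinuous hglsc hx1 hglim fun j =>
      (coe_toReal_of_mem_edom hgP (hxg _)).ge
  have hgxb : xb ∈ edom g := (hgle.trans_lt (EReal.coe_lt_top _)).ne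
  have hVIlim : ∀ w ∈ S, w ∈ edom g → θbar * (f (K xb)).toReal - h xb ≤ (g w).toReal
      + ⟪gh xb, w - xb⟫ - θbar * ⟪yb, K (w - xb)⟫ := by
    intro w hw hwg
    have hd : Tendsto (fun j => w - x (κ j + 1)) atTop (𝓝 (w - xb)) := tendsto_const_nhds.sub hx1
    have h1 := (((tendsto_const_nhds (x := (g w).toReal)).add
      (((hxu.comp hκ).inner hd).const_mul δ⁻¹)).add (hghlim.inner hd)).sub
      (hθ0.mul (hy1.inner ((hKcont.tendsto _).comp hd)))
    have h2 := le_of_tendsto_of_tendsto' hglim h1 fun j => hVI (κ j) w hw hwg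
    simpa using h2
  have hgval : (g xb).toReal = θbar * (f (K xb)).toReal - h xb := by
    rw [← coe_toReal_of_mem_edom hgP hgxb, EReal.coe_le_coe_iff] at hgle
    refine le_antisymm hgle ?_
    simpa using hVIlim xb hxb hgxb
  obtain ⟨v, hv, w, hw, hvw⟩ := exists_mem_csubdiff_mem_normalCone hSconv hgP hgconv hA2
    (q := gh xb - θbar • (LinearMap.adjoint K) yb) hxb hgxb fun w hw hwg => by
      have := hVIlim w hw hwg
      rw [hgval, inner_sub_left, real_inner_smul_left, LinearMap.adjoint_inner_left]
      linarith
  have hval : g xb + ((h xb : ℝ) : EReal) = ((θbar * (f (K xb)).toReal : ℝ) : EReal) := by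
    rw [← coe_toReal_of_mem_edom hgP hgxb, ← EReal.coe_add, hgval, sub_add_cancel]
  refine ⟨⟨v, hv, w, hw, yb, hyb, ?_⟩, ?_⟩
  · have h1 : v + gh xb + w = θbar • (LinearMap.adjoint K) yb := by
      rw [← sub_eq_zero, ← hvw]
      abel
    rw [hval, EReal.toReal_coe, h1, smul_smul, mul_comm, sub_self]
  · rw [hval]
    nth_rewrite 2 [← coe_toReal_of_mem_edom hfP (hfdom xb hxb)]
    rw [← EReal.coe_div, mul_div_cancel_right₀ _ (hFpos xb hxb).ne']
end
end
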